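/- arXiv:2011.10128 — 2 statements merged into one kernel-verified Lean document; each statement's English description precedes it below -/
import Mathlib

section
/- Telescoping sum identity (Lemma: full sum S^{n-1}): with T_s := (Π_{t=r+s+1}^{r+n-1} x_j^{(t+1)}) (Π_{t=s+2}^{s+n-1} σ_{(n-1)(j-i)}^{(r-j+i+t)}(x_i,...,x_j)) σ_{(n-1)(j-i-1)}^{(r-j+i+s+1)}(x_i,...,x_{j-1}) (Π_{t=1}^{s} x_i^{(r-j+i+t)}), one has Σ_{s=0}^{n-1} T_s = Π_{t=1}^{n-1} σ_{(n-1)(j-i)}^{(r-j+i+t)}(x_i, ..., x_j). All upper indices mod n. -/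
open Finset

noncomputable section BirationalR

/-- A vector of reals with cyclically indexed coordinates (upper index mod `n`). -/
abbrev Vec (n : ℕ) := ZMod n → ℝ

/-- `κ_r(a,b) = Σ_{j=r}^{r+n-1} (Π_{k=r+1}^{j} b_k)(Π_{k=j+1}^{r+n-1} a_k)`, indices mod `n`. -/
def kappaF (n : ℕ) (r : ZMod n) (a b : Vec n) : ℝ :=
  ∑ d ∈ Finset.range n,
    (∏ t ∈ Finset.range d, b (r + 1 + (t : ℕ))) *
      ∏ t ∈ Finset.range (n - 1 - d), a (r + 1 + (d : ℕ) + (t : ℕ))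

/-- First component `b'` of the birational R-matrix `η(a,b) = (b',a')`:
`b'_i = b_{i+1} κ_{i+1}(a,b)/κ_i(a,b)`. -/
def etaB (n : ℕ) (a b : Vec n) : Vec n :=
  fun i => b (i + 1) * kappaF n (i + 1) a b / kappaF n i a b

/-- Second component `a'` of `η(a,b) = (b',a')`: `a'_i = a_{i-1} κ_{i-1}(a,b)/κ_i(a,b)`. -/
def etaA (n : ℕ) (a b : Vec n) : Vec n :=
  fun i => a (i - 1) * kappaF n (i - 1) a b / kappaF n i a b

/-- `η` applied to positions `(p, p+1)` of a tuple of vectors. -/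
def etaAt (n : ℕ) (p : ℕ) (X : ℕ → Vec n) : ℕ → Vec n :=
  fun q => if q = p then etaB n (X p) (X (p + 1))
    else if q = p + 1 then etaA n (X p) (X (p + 1)) else X q

/-- Action of the word `s_{w₁} s_{w₂} ⋯ s_{wₗ}` (rightmost acts first). -/
def applyWord (n : ℕ) (w : List ℕ) (X : ℕ → Vec n) : ℕ → Vec n :=
  w.foldr (etaAt n) X

/-- The tuple `(x_i, x_{i+1}, …, x_j)` as a list. -/
def seg {n : ℕ} (x : ℕ → Vec n) (i j : ℕ) : List (Vec n) :=
  (List.range (j + 1 - i)).map fun t => x (i + t)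

/-- `τ_k^{(r)}(x_1,…,x_m)`: sum over weakly increasing `i_1 ≤ … ≤ i_k`, no index used
more than `n-1` times, of `x_{i_1}^{(r)} x_{i_2}^{(r-1)} ⋯ x_{i_k}^{(r-k+1)}`.
Encoded via multiplicity functions; `τ = 0` for negative `k`. -/
def tauF (n : ℕ) (r : ZMod n) (k : ℤ) (x : List (Vec n)) : ℝ :=
  if 0 ≤ k then
    ∑ c ∈ (Fintype.piFinset fun _ : Fin x.length => Finset.range n).filter
        (fun c => ∑ i, c i = k.toNat),
      ∏ i : Fin x.length, ∏ β ∈ Finset.range (c i),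
        x.get i (r - (∑ i' ∈ Finset.univ.filter (fun i' => i' < i), c i' : ℕ) - (β : ℕ))
  else 0

/-- `σ_k^{(r)}(x_1,…,x_m) = Σ_{t=0}^{k} x_1^{(r)} ⋯ x_1^{(r-t+1)} τ_{k-t}^{(r-t)}(x_2,…,x_m)`. -/
def sigmaF (n : ℕ) (r : ZMod n) (k : ℕ) : List (Vec n) → ℝ
  | [] => if k = 0 then 1 else 0
  | y :: rest =>
      ∑ t ∈ Finset.range (k + 1),
        (∏ β ∈ Finset.range t, y (r - (β : ℕ))) * tauF n (r - (t : ℕ)) ((k : ℤ) - (t : ℤ)) rest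

/-- `σ̄_k^{(r)}(x_1,…,x_m) = Σ_{t=0}^{k} τ_{k-t}^{(r)}(x_1,…,x_{m-1}) x_m^{(r-k+t)} ⋯ x_m^{(r-k+1)}`. -/
def sigmaBarF (n : ℕ) (r : ZMod n) (k : ℕ) : List (Vec n) → ℝ
  | [] => if k = 0 then 1 else 0
  | y :: rest =>
      ∑ t ∈ Finset.range (k + 1),
        tauF n r ((k : ℤ) - (t : ℤ)) ((y :: rest).dropLast) *
          ∏ β ∈ Finset.range t,
            (y :: rest).getLast (List.cons_ne_nil y rest) (r - (k : ℕ) + 1 + (β : ℕ))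

/-- `Ω_k^{(r)}(x_i,…,x_j) = Σ_{ℓ=0}^{n-1} σ^{(r)}_{(n-1)(k-i)+ℓ}(x_i,…,x_k)
σ̄^{(r+k-i-ℓ)}_{(n-1)(j-k)-ℓ}(x_{k+1},…,x_j)`. -/
def OmegaF (n : ℕ) (r : ZMod n) (k i j : ℕ) (x : ℕ → Vec n) : ℝ :=
  ∑ ℓ ∈ Finset.range n,
    sigmaF n r ((n - 1) * (k - i) + ℓ) (seg x i k) *
      sigmaBarF n (r + (k : ℕ) - (i : ℕ) - (ℓ : ℕ)) ((n - 1) * (j - k) - ℓ) (seg x (k + 1) j)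

/-- `P_k^{(r)}(x_i,…,x_j) = Σ_{t=0}^{k} (Π_{s=0}^{t-1} x_i^{(r-s)})
σ_{(n-1)(j-i-1)}^{(r-t)}(x_i,…,x_{j-1}) (Π_{s=0}^{k-t-1} x_j^{(r-t+j-i-1-s)})`. -/
def PF (n : ℕ) (r : ZMod n) (k i j : ℕ) (x : ℕ → Vec n) : ℝ :=
  ∑ t ∈ Finset.range (k + 1),
    (∏ s ∈ Finset.range t, x i (r - (s : ℕ))) *
      sigmaF n (r - (t : ℕ)) ((n - 1) * (j - i - 1)) (seg x i (j - 1)) *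
      ∏ s ∈ Finset.range (k - t), x j (r - (t : ℕ) + (j : ℕ) - (i : ℕ) - 1 - (s : ℕ))

end BirationalR

/-- The summand `T_s = (Π_{t=r+s+1}^{r+n-1} x_j^{(t+1)})
(Π_{t=s+2}^{s+n-1} σ_{(n-1)(j-i)}^{(r-j+i+t)}(x_i,…,x_j))
σ_{(n-1)(j-i-1)}^{(r-j+i+s+1)}(x_i,…,x_{j-1}) (Π_{t=1}^{s} x_i^{(r-j+i+t)})`. -/
noncomputable def TF (n : ℕ) (r : ZMod n) (i j : ℕ) (x : ℕ → Vec n) (s : ℕ) : ℝ :=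
  (∏ u ∈ Finset.range (n - 1 - s), x j (r + (s : ℕ) + 1 + (u : ℕ) + 1)) *
    (∏ u ∈ Finset.range (n - 2),
      sigmaF n (r - (j : ℕ) + (i : ℕ) + ((s : ℕ) + 2 + (u : ℕ))) ((n - 1) * (j - i)) (seg x i j)) *
    sigmaF n (r - (j : ℕ) + (i : ℕ) + (s : ℕ) + 1) ((n - 1) * (j - i - 1)) (seg x i (j - 1)) *
    ∏ u ∈ Finset.range s, x i (r - (j : ℕ) + (i : ℕ) + ((u : ℕ) + 1))

/-- The polynomials `τ_k^{(r)}(f_0,…,f_{m-1})`, defined by recursion on the last variable. -/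
noncomputable def tauRec (n : ℕ) (f : ℕ → Vec n) : ℕ → ℤ → ZMod n → ℝ
  | 0, k, _ => if k = 0 then 1 else 0
  | m + 1, k, r => ∑ b ∈ Finset.range n,
      tauRec n f m (k - b) r * ∏ β ∈ Finset.range b, f m (r - k + b - (β : ℕ))

/-- The polynomials `σ_k^{(r)}(y,f_0,…,f_{m-1})`. -/
noncomputable def sigmaRec (n : ℕ) (y : Vec n) (f : ℕ → Vec n) (m : ℕ) (k : ℤ) (r : ZMod n) : ℝ :=
  ∑ t ∈ Finset.range (k + 1).toNat,
    (∏ β ∈ Finset.range t, y (r - (β : ℕ))) * tauRec n f m (k - t) (r - (t : ℕ))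

theorem tauRec_of_neg {n : ℕ} (f : ℕ → Vec n) (m : ℕ) {k : ℤ} (r : ZMod n) (hk : k < 0) :
    tauRec n f m k r = 0 := by
  induction m generalizing k with
  | zero => simp [tauRec, hk.ne]
  | succ m ih =>
    refine Finset.sum_eq_zero fun b _ => ?_
    rw [ih (by omega), zero_mul]

theorem tauRec_of_lt {n : ℕ} (f : ℕ → Vec n) (m : ℕ) {k : ℤ} (r : ZMod n)
    (hk : ((n : ℤ) - 1) * m < k) : tauRec n f m k r = 0 := by
  induction m generalizing k with
  | zero =>
    have : k ≠ 0 := by rintro rfl; simp at hk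
    simp [tauRec, this]
  | succ m ih =>
    refine Finset.sum_eq_zero fun b hb => ?_
    have := Finset.mem_range.1 hb
    push_cast at hk
    rw [ih (by linarith [(by omega : (b : ℤ) ≤ n - 1)]), zero_mul]

theorem tauRec_eq_sum {n : ℕ} (f : ℕ → Vec n) (m : ℕ) (k : ℤ) (r : ZMod n) :
    tauRec n f m k r =
      ∑ c ∈ Fintype.piFinset fun _ : Fin m => Finset.range n,
        if ((∑ i, c i : ℕ) : ℤ) = k then
          ∏ i : Fin m, ∏ β ∈ Finset.range (c i),
            f i (r - (∑ i', if i' < i then c i' else 0 : ℕ) - (β : ℕ))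
        else 0 := by
  induction m generalizing k with
  | zero => simp [tauRec, eq_comm]
  | succ m ih =>
    simp only [tauRec, ih, Finset.sum_mul]
    rw [← Finset.sum_product']
    refine Finset.sum_bij' (fun p _ => Fin.snoc (α := fun _ => ℕ) p.2 p.1)
      (fun c _ => (c (Fin.last m), Fin.init (α := fun _ => ℕ) c)) ?_ ?_ ?_ ?_ ?_
    · rintro ⟨b, c⟩ h
      simp only [Finset.mem_product, Fintype.mem_piFinset, Finset.mem_range] at h ⊢
      intro a
      refine Fin.lastCases ?_ (fun a => ?_) a
      · simpa using h.1
      · simpa using h.2 a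
    · intro c h
      simp only [Finset.mem_product, Fintype.mem_piFinset, Finset.mem_range] at h ⊢
      exact ⟨h _, fun a => h _⟩
    · rintro ⟨b, c⟩ h
      simp
    · intro c h
      simp
    · rintro ⟨b, c⟩ h
      simp only [Fin.sum_univ_castSucc, Fin.prod_univ_castSucc, Fin.snoc_castSucc, Fin.snoc_last,
        Fin.castSucc_lt_castSucc_iff, Fin.val_castSucc, Fin.val_last, Fin.castSucc_lt_last,
        if_true, lt_irrefl, if_false, (Fin.castSucc_lt_last _).not_gt, add_zero]
      by_cases hk : ((∑ i, c i : ℕ) : ℤ) = k - b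
      · have hr : (k : ZMod n) = ((∑ i, c i : ℕ) : ZMod n) + (b : ZMod n) := by
          rw [← sub_eq_iff_eq_add]
          exact_mod_cast (congrArg (Int.cast : ℤ → ZMod n) hk).symm
        rw [if_pos hk, if_pos (by push_cast at hk ⊢; linarith), hr]
        congr 1
        refine Finset.prod_congr rfl fun β _ => ?_
        congr 1
        ring
      · rw [if_neg hk, if_neg (by push_cast at hk ⊢; intro h; exact hk (by linarith)), zero_mul]

theorem tauF_eq_tauRec {n : ℕ} (f : ℕ → Vec n) (l : List (Vec n))
    (hl : ∀ a : Fin l.length, l.get a = f a) (k : ℤ) (r : ZMod n) :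
    tauF n r k l = tauRec n f l.length k r := by
  by_cases hk : 0 ≤ k
  · rw [tauRec_eq_sum, tauF, if_pos hk, Finset.sum_filter]
    refine Finset.sum_congr rfl fun c _ => ?_
    simp only [hl, Finset.sum_filter]
    exact if_congr (by omega) rfl rfl
  · rw [tauF, if_neg hk, tauRec_of_neg f _ r (not_le.1 hk)]

theorem sigmaF_seg_eq_sigmaRec {n : ℕ} (x : ℕ → Vec n) (i m k : ℕ) (r : ZMod n) :
    sigmaF n r k (seg x i (i + m)) = sigmaRec n (x i) (fun t => x (i + 1 + t)) m k r := by
  have hs : seg x i (i + m) = x i :: (List.range m).map fun t => x (i + 1 + t) := by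
    rw [seg, show i + m + 1 - i = m + 1 by omega, List.range_succ_eq_map]
    simp [Function.comp_def, add_assoc, add_comm 1]
  rw [hs, sigmaF, sigmaRec, show ((k : ℤ) + 1).toNat = k + 1 by omega]
  refine Finset.sum_congr rfl fun t _ => ?_
  rw [tauF_eq_tauRec (fun t => x (i + 1 + t)) _ (fun a => by simp)]
  simp

theorem sigmaRec_eq_sum_range {n : ℕ} (y : Vec n) (f : ℕ → Vec n) (m : ℕ) {k : ℤ} (r : ZMod n)
    {M : ℕ} (hM : k < M) :
    sigmaRec n y f m k r = ∑ t ∈ Finset.range M,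
      (∏ β ∈ Finset.range t, y (r - (β : ℕ))) * tauRec n f m (k - t) (r - (t : ℕ)) := by
  refine Finset.sum_subset (fun t ht => ?_) fun t _ ht => ?_
  · simp only [Finset.mem_range] at ht ⊢
    omega
  · simp only [Finset.mem_range] at ht
    rw [tauRec_of_neg f m _ (by omega), mul_zero]

theorem prod_range_succ_sub {n : ℕ} (y : Vec n) (r : ZMod n) (t : ℕ) :
    ∏ β ∈ Finset.range (t + 1), y (r - (β : ℕ)) =
      y r * ∏ β ∈ Finset.range t, y (r - 1 - (β : ℕ)) := by
  rw [Finset.prod_range_succ', mul_comm, Nat.cast_zero, sub_zero]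
  congr 1
  exact Finset.prod_congr rfl fun β _ => by congr 1; push_cast; ring

theorem mul_sigmaRec_sub_one {n : ℕ} (y : Vec n) (f : ℕ → Vec n) (m : ℕ) {k : ℤ}
    (r : ZMod n) (hk : ((n : ℤ) - 1) * m ≤ k) :
    y r * sigmaRec n y f m k (r - 1) = sigmaRec n y f m (k + 1) r := by
  have hM : k < (k + 1).toNat := by omega
  rw [sigmaRec_eq_sum_range y f m _ hM,
    sigmaRec_eq_sum_range y f m (M := (k + 1).toNat + 1) r (by push_cast; omega),
    Finset.sum_range_succ', tauRec_of_lt f m (k := k + 1 - (0 : ℕ)) _ (by push_cast; omega),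
    mul_zero, add_zero, Finset.mul_sum]
  refine Finset.sum_congr rfl fun t _ => ?_
  rw [prod_range_succ_sub, mul_assoc, show k + 1 - ((t + 1 : ℕ) : ℤ) = k - t by push_cast; ring,
    show r - ((t + 1 : ℕ) : ZMod n) = r - 1 - t by push_cast; ring]

theorem sigmaRec_add {n : ℕ} (y : Vec n) (f : ℕ → Vec n) (m : ℕ) {k : ℤ}
    (r : ZMod n) (hk : ((n : ℤ) - 1) * m ≤ k) (d : ℕ) :
    sigmaRec n y f m (k + d) r =
      (∏ β ∈ Finset.range d, y (r - (β : ℕ))) * sigmaRec n y f m k (r - (d : ℕ)) := by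
  induction d generalizing r with
  | zero => simp
  | succ d ih =>
    rw [Nat.cast_succ, ← add_assoc, ← mul_sigmaRec_sub_one y f m r (by omega), ih,
      prod_range_succ_sub, mul_assoc,
      show r - ((d + 1 : ℕ) : ZMod n) = r - 1 - d by push_cast; ring]

theorem sigmaRec_succ {n : ℕ} (y : Vec n) (f : ℕ → Vec n) (m : ℕ) (k : ℤ) (r : ZMod n) :
    sigmaRec n y f (m + 1) k r = ∑ b ∈ Finset.range n,
      sigmaRec n y f m (k - b) r * ∏ β ∈ Finset.range b, f m (r - k + b - (β : ℕ)) := by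
  have hM : k < (k + 1).toNat := by omega
  have h : ∀ b : ℕ, sigmaRec n y f m (k - b) r = _ := fun b =>
    sigmaRec_eq_sum_range y f m r (M := (k + 1).toNat) (by omega)
  simp only [h]
  rw [sigmaRec_eq_sum_range y f _ r hM]
  simp only [tauRec, Finset.mul_sum, Finset.sum_mul]
  rw [Finset.sum_comm]
  refine Finset.sum_congr rfl fun b _ => Finset.sum_congr rfl fun t _ => ?_
  rw [← mul_assoc, show k - (t : ℤ) - b = k - b - t by ring]
  congr 1
  refine Finset.prod_congr rfl fun β _ => ?_
  congr 1
  push_cast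
  ring

theorem prod_range_add_eq_prod_univ {n : ℕ} [NeZero n] (g : Vec n) (a : ZMod n) :
    ∏ u ∈ Finset.range n, g (a + (u : ℕ)) = ∏ c, g c := by
  refine Finset.prod_bij' (fun u _ => a + (u : ℕ)) (fun c _ => (c - a).val) ?_ ?_ ?_ ?_ ?_
  · simp
  · intro c _
    exact Finset.mem_range.2 (ZMod.val_lt _)
  · intro u hu
    simpa using ZMod.val_cast_of_lt (Finset.mem_range.1 hu)
  · simp
  · simp

theorem prod_range_sub_eq_prod_univ {n : ℕ} [NeZero n] (g : Vec n) (a : ZMod n) :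
    ∏ u ∈ Finset.range n, g (a - (u : ℕ)) = ∏ c, g c := by
  have h := prod_range_add_eq_prod_univ (fun c => g (-c)) (-a)
  rw [Fintype.prod_equiv (Equiv.neg (ZMod n)) (fun c => g (-c)) g (fun _ => rfl)] at h
  rw [← h]
  exact Finset.prod_congr rfl fun u _ => by congr 1; ring

/-- The exchange relation behind the telescoping sum. -/
theorem mul_sigmaRec_sub_mul_sigmaRec {n : ℕ} [NeZero n] (y : Vec n) (f : ℕ → Vec n) (m : ℕ)
    (p : ZMod n) :
    y p * sigmaRec n y f (m + 1) (((n : ℤ) - 1) * (m + 1)) (p - 1) -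
        f m (p + m + 1) * sigmaRec n y f (m + 1) (((n : ℤ) - 1) * (m + 1)) p =
      (∏ c, y c - ∏ c, f m c) * sigmaRec n y f m (((n : ℤ) - 1) * m) p := by
  set N : ℤ := ((n : ℤ) - 1) * (m + 1) with hN
  have hNp : (N : ZMod n) = -(m + 1) := by
    rw [hN]
    push_cast
    rw [CharP.cast_eq_zero (ZMod n) n]
    ring
  have hNn : N + 1 = ((n : ℤ) - 1) * m + n := by rw [hN]; ring
  have hfirst := sigmaRec_add y f m p (le_refl (((n : ℤ) - 1) * m)) n
  rw [prod_range_sub_eq_prod_univ, CharP.cast_eq_zero (ZMod n) n, sub_zero, ← hNn] at hfirst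
  have hlast : f m (p + m + 1) * sigmaRec n y f (m + 1) N p =
      ∑ b ∈ Finset.range n, sigmaRec n y f m (N + 1 - (b + 1 : ℕ)) p *
        ∏ β ∈ Finset.range (b + 1), f m (p - (N + 1 : ℤ) + (b + 1 : ℕ) - (β : ℕ)) := by
    rw [sigmaRec_succ, Finset.mul_sum]
    refine Finset.sum_congr rfl fun b _ => ?_
    rw [Finset.prod_range_succ, mul_left_comm, mul_comm (f m _)]
    congr 2
    · push_cast; ring
    · refine Finset.prod_congr rfl fun β _ => ?_
      congr 1
      push_cast
      ring
    · congr 1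
      push_cast
      rw [hNp]
      ring
  have htop := prod_range_sub_eq_prod_univ (f m) (p - (N + 1 : ℤ) + (n : ℕ))
  have hsum := Finset.sum_range_succ' (fun b : ℕ => sigmaRec n y f m (N + 1 - b) p *
    ∏ β ∈ Finset.range b, f m (p - (N + 1 : ℤ) + (b : ℕ) - (β : ℕ))) n
  rw [Finset.sum_range_succ, ← hlast, ← sigmaRec_succ, htop,
    show N + 1 - (n : ℤ) = ((n : ℤ) - 1) * m by rw [hNn]; ring] at hsum
  simp only [Nat.cast_zero, sub_zero, Finset.range_zero, Finset.prod_empty, mul_one,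
    hfirst] at hsum
  rw [mul_sigmaRec_sub_one y f (m + 1) p (by rw [hN]; push_cast; exact le_rfl)]
  linear_combination hsum

/-- Telescoping of a sum of cyclic products, for any cyclic sequences satisfying the exchange
relation. -/
theorem mul_sum_eq_mul_prod_of_exchange {n : ℕ} [NeZero n] (hn : 2 ≤ n) (a b A B : Vec n)
    (q r : ZMod n)
    (h : ∀ s : ZMod n, a (q + s + 1) * A (q + s) - b (r + s + 1) * A (q + s + 1) =
      (∏ c, a c - ∏ c, b c) * B (q + s + 1)) :
    (∏ c, a c - ∏ c, b c) * ∑ s ∈ Finset.range n,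
        (∏ u ∈ Finset.range (n - 1 - s), b (r + (s : ℕ) + 1 + (u : ℕ) + 1)) *
          (∏ u ∈ Finset.range (n - 2), A (q + ((s : ℕ) + 2 + (u : ℕ)))) *
          B (q + (s : ℕ) + 1) * ∏ u ∈ Finset.range s, a (q + ((u : ℕ) + 1)) =
      (∏ c, a c - ∏ c, b c) * ∏ t ∈ Finset.range (n - 1), A (q + ((t : ℕ) + 1)) := by
  let C : ℕ → ℝ := fun s => (∏ u ∈ Finset.range (n - s), b (r + (s : ℕ) + 1 + (u : ℕ))) *
    ∏ u ∈ Finset.range s, a (q + ((u : ℕ) + 1))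
  let W : ℕ → ℝ := fun s => ∏ u ∈ Finset.range (n - 1), A (q + (s : ℕ) + ((u : ℕ) + 1))
  have hCn : C n = ∏ c, a c := by
    rw [← prod_range_add_eq_prod_univ a (q + 1)]
    simp only [C, Nat.sub_self, Finset.range_zero, Finset.prod_empty, one_mul]
    exact Finset.prod_congr rfl fun u _ => by congr 1; ring
  have hC0 : C 0 = ∏ c, b c := by
    rw [← prod_range_add_eq_prod_univ b (r + 1)]
    simp [C]
  have hW0 : W 0 = ∏ t ∈ Finset.range (n - 1), A (q + ((t : ℕ) + 1)) := by simp [W]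
  have hWn : W n = W 0 := by simp [W]
  have htel := Finset.sum_range_sub (fun s => C s * W s) n
  rw [hWn, hCn, hC0, ← sub_mul, hW0] at htel
  rw [← htel, Finset.mul_sum]
  refine Finset.sum_congr rfl fun s hs => ?_
  have hsn := Finset.mem_range.1 hs
  have hC : C s = (∏ u ∈ Finset.range (n - 1 - s), b (r + (s : ℕ) + 1 + (u : ℕ) + 1)) *
      b (r + s + 1) * ∏ u ∈ Finset.range s, a (q + ((u : ℕ) + 1)) := by
    simp only [C]
    rw [show n - s = n - 1 - s + 1 by omega, Finset.prod_range_succ', Nat.cast_zero, add_zero]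
    simp only [Nat.cast_succ, add_assoc]
  have hC' : C (s + 1) = (∏ u ∈ Finset.range (n - 1 - s), b (r + (s : ℕ) + 1 + (u : ℕ) + 1)) *
      ((∏ u ∈ Finset.range s, a (q + ((u : ℕ) + 1))) * a (q + s + 1)) := by
    simp only [C]
    rw [show n - (s + 1) = n - 1 - s by omega, Finset.prod_range_succ, add_assoc q]
    congr 1
    exact Finset.prod_congr rfl fun u _ => by congr 1; push_cast; ring
  have hW : W s = (∏ u ∈ Finset.range (n - 2), A (q + ((s : ℕ) + 2 + (u : ℕ)))) *
      A (q + s + 1) := by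
    simp only [W]
    rw [show n - 1 = n - 2 + 1 by omega, Finset.prod_range_succ', Nat.cast_zero, zero_add]
    congr 1
    exact Finset.prod_congr rfl fun u _ => by congr 1; push_cast; ring
  have hW' : W (s + 1) = (∏ u ∈ Finset.range (n - 2), A (q + ((s : ℕ) + 2 + (u : ℕ)))) *
      A (q + s) := by
    simp only [W]
    rw [show n - 1 = n - 2 + 1 by omega, Finset.prod_range_succ]
    congr 1
    · exact Finset.prod_congr rfl fun u _ => by congr 1; push_cast; ring
    · congr 1
      rw [Nat.cast_sub hn, CharP.cast_eq_zero (ZMod n) n]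
      push_cast
      ring
  rw [hC, hC', hW, hW']
  linear_combination (-(∏ u ∈ Finset.range (n - 1 - s), b (r + (s : ℕ) + 1 + (u : ℕ) + 1)) *
    (∏ u ∈ Finset.range (n - 2), A (q + ((s : ℕ) + 2 + (u : ℕ)))) *
    ∏ u ∈ Finset.range s, a (q + ((u : ℕ) + 1))) * h s

theorem continuous_sigmaRec {n : ℕ} (f : ℕ → Vec n) (m : ℕ) (k : ℤ) (r : ZMod n) :
    Continuous fun y : Vec n => sigmaRec n y f m k r := by
  unfold sigmaRec
  fun_prop

theorem sum_sigmaRec_eq_prod {n : ℕ} [NeZero n] (hn : 2 ≤ n) (y : Vec n) (hy : ∀ c, 0 < y c)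
    (f : ℕ → Vec n) (m : ℕ) (q r : ZMod n) (hr : r = q + m + 1) :
    ∑ s ∈ Finset.range n,
        (∏ u ∈ Finset.range (n - 1 - s), f m (r + (s : ℕ) + 1 + (u : ℕ) + 1)) *
          (∏ u ∈ Finset.range (n - 2), sigmaRec n y f (m + 1) (((n : ℤ) - 1) * (m + 1))
            (q + ((s : ℕ) + 2 + (u : ℕ)))) *
          sigmaRec n y f m (((n : ℤ) - 1) * m) (q + (s : ℕ) + 1) *
          ∏ u ∈ Finset.range s, y (q + ((u : ℕ) + 1)) =
      ∏ t ∈ Finset.range (n - 1),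
        sigmaRec n y f (m + 1) (((n : ℤ) - 1) * (m + 1)) (q + ((t : ℕ) + 1)) := by
  have generic : ∀ z : Vec n, ∏ c, z c ≠ ∏ c, f m c → _ := fun z hz =>
    mul_left_cancel₀ (sub_ne_zero.2 hz) <|
      mul_sum_eq_mul_prod_of_exchange hn z (f m)
        (sigmaRec n z f (m + 1) (((n : ℤ) - 1) * (m + 1)))
        (sigmaRec n z f m (((n : ℤ) - 1) * m)) q r fun s => by
          rw [← mul_sigmaRec_sub_mul_sigmaRec z f m (q + s + 1), add_sub_cancel_right,
            show r + s + 1 = q + s + 1 + m + 1 by rw [hr]; ring]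
  by_cases hP : ∏ c, y c = ∏ c, f m c
  · have hpos : 0 < ∏ c, y c := Finset.prod_pos fun c _ => hy c
    have hσ := continuous_sigmaRec (n := n) f
    have hmem : (1 : ℝ) ∈ closure (Set.Ioi 1) := by simp
    have heq := Set.EqOn.closure (s := Set.Ioi (1 : ℝ))
      (fun c (hc : 1 < c) => generic (c • y) (by
        have hlt : 1 < c ^ n := one_lt_pow₀ hc (NeZero.ne n)
        simp only [Pi.smul_apply, smul_eq_mul, Finset.prod_mul_distrib, Finset.prod_const,
          Finset.card_univ, ZMod.card, ← hP]
        nlinarith)) (by fun_prop) (by fun_prop) hmem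
    simpa only [one_smul] using heq
  · exact generic y hP

/-- telescoping full sum:
`Σ_{s=0}^{n-1} T_s = Π_{t=1}^{n-1} σ_{(n-1)(j-i)}^{(r-j+i+t)}(x_i,…,x_j)`. -/
theorem T_full_sum (n : ℕ) (hn : 2 ≤ n) (x : ℕ → Vec n) (hx : ∀ p r, 0 < x p r)
    (i j : ℕ) (hi : 1 ≤ i) (hij : i < j) (r : ZMod n) :
    ∑ s ∈ Finset.range n, TF n r i j x s =
      ∏ t ∈ Finset.range (n - 1),
        sigmaF n (r - (j : ℕ) + (i : ℕ) + ((t : ℕ) + 1)) ((n - 1) * (j - i)) (seg x i j) := by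
  have : NeZero n := ⟨by omega⟩
  obtain ⟨m, rfl⟩ : ∃ m, j = i + (m + 1) := ⟨j - i - 1, by omega⟩
  have hq : r = r - ((i + (m + 1) : ℕ) : ZMod n) + i + m + 1 := by push_cast; ring
  have key := sum_sigmaRec_eq_prod hn (x i) (hx i) (fun t => x (i + 1 + t)) m _ r hq
  have hA : (((n - 1) * (i + (m + 1) - i) : ℕ) : ℤ) = ((n : ℤ) - 1) * (m + 1) := by
    rw [Nat.add_sub_cancel_left, Nat.cast_mul, Nat.cast_sub (by omega)]
    push_cast
    ring
  have hB : (((n - 1) * (i + (m + 1) - i - 1) : ℕ) : ℤ) = ((n : ℤ) - 1) * m := by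
    rw [Nat.add_sub_cancel_left, Nat.add_sub_cancel, Nat.cast_mul, Nat.cast_sub (by omega)]
    push_cast
    ring
  simp only [TF, show i + (m + 1) - 1 = i + m by omega, sigmaF_seg_eq_sigmaRec, hA, hB]
  rw [show i + 1 + m = i + (m + 1) by ring] at key
  exact key
end

section
/- Main identity relating Ω_{k-1} and Ω_k: for i < k ≤ j-1, (Π_{t=1}^{n-1} σ_{(n-1)(k-i)}^{(r-k+i+t)}(x_i,...,x_k)) · Ω_{k-1}^{(r-k+i)}(x_i,...,x_j) = Σ_{s=0}^{n-1} (Π_{t=r+1}^{r+s} x_j^{(t+j-k)}) (Π_{t=r+s+1}^{r+n-1} x_k^{(t+1)}) (Π_{t=s+2}^{s+n-1} σ_{(n-1)(k-i)}^{(r-k+i+t)}(x_i,...,x_k)) Ω_k^{(r-k+i+s)}(x_i,...,x_j) σ_{(n-1)(k-i-1)}^{(r-k+i+s+1)}(x_i,...,x_{k-1}), with upper indices mod n. -/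
open Finset

/-- `y^{(r)} y^{(r-1)} ⋯ y^{(r-t+1)}`. -/
def descProd {n : ℕ} (y : Vec n) (r : ZMod n) (t : ℕ) : ℝ :=
  ∏ β ∈ Finset.range t, y (r - (β : ℕ))

lemma descProd_succ {n : ℕ} (y : Vec n) (r : ZMod n) (t : ℕ) :
    descProd y r (t + 1) = descProd y r t * y (r - t) :=
  Finset.prod_range_succ _ _

lemma descProd_add {n : ℕ} (y : Vec n) (r : ZMod n) (s t : ℕ) :
    descProd y r (s + t) = descProd y r s * descProd y (r - s) t := by
  simp only [descProd, Finset.prod_range_add, Nat.cast_add, sub_sub]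

lemma descProd_succ' {n : ℕ} (y : Vec n) (r : ZMod n) (t : ℕ) :
    descProd y r (t + 1) = y r * descProd y (r - 1) t := by
  rw [add_comm, descProd_add]
  simp [descProd]

lemma descProd_self {n : ℕ} [NeZero n] (y : Vec n) (r : ZMod n) :
    descProd y r n = ∏ m, y m := by
  refine Finset.prod_nbij (fun t : ℕ => r - t) (by simp) ?_ ?_ (by simp)
  · intro s hs t ht h
    have h' : (s : ZMod n) = t := by simpa using h
    rw [ZMod.natCast_eq_natCast_iff'] at h'
    simp only [Finset.coe_range, Set.mem_Iio] at hs ht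
    rwa [Nat.mod_eq_of_lt hs, Nat.mod_eq_of_lt ht] at h'
  · intro m _
    refine ⟨(r - m).val, by simpa using ZMod.val_lt _, ?_⟩
    simp

lemma prod_range_cyclic {n : ℕ} [NeZero n] (y : Vec n) (r : ZMod n) :
    ∏ t ∈ Finset.range n, y (r + (t : ℕ)) = ∏ m, y m := by
  have h := descProd_self (fun m => y (-m)) (-r)
  simp only [descProd, neg_sub, sub_neg_eq_add] at h
  rw [← Equiv.prod_comp (Equiv.neg (ZMod n)) y]
  simpa [add_comm] using h

/-- The interpolating sum
`Σ_{ℓ=0}^{n-1} a^{(r)} ⋯ a^{(r-ℓ+1)} f^{(r-ℓ)} b^{(r-ℓ-1)} ⋯ b^{(r-n+1)}`. -/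
def kappaSum (n : ℕ) (a b f : Vec n) : Vec n := fun r =>
  ∑ ℓ ∈ Finset.range n,
    descProd a r ℓ * f (r - (ℓ : ℕ)) * descProd b (r - (ℓ : ℕ) - 1) (n - 1 - ℓ)

lemma kappaSum_recurrence {n : ℕ} [NeZero n] (a b f : Vec n) (r : ZMod n) :
    a (r + 1) * kappaSum n a b f r - b (r + 1) * kappaSum n a b f (r + 1) =
      (∏ m, a m - ∏ m, b m) * f (r + 1) := by
  let H : ℕ → ℝ := fun ℓ =>
    descProd a (r + 1) ℓ * f (r + 1 - (ℓ : ℕ)) * descProd b (r - (ℓ : ℕ)) (n - ℓ)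
  have htel := Finset.sum_range_sub H n
  have hends : H n - H 0 = (∏ m, a m - ∏ m, b m) * f (r + 1) := by
    simp only [H, descProd_self, CharP.cast_eq_zero, sub_zero, Nat.sub_zero, Nat.cast_zero,
      Nat.sub_self]
    simp [descProd]
    ring
  rw [← hends, ← htel, kappaSum, kappaSum, Finset.mul_sum, Finset.mul_sum,
    ← Finset.sum_sub_distrib]
  refine Finset.sum_congr rfl fun ℓ hℓ => ?_
  have hlt := Finset.mem_range.mp hℓ
  have e₁ : n - ℓ = n - 1 - ℓ + 1 := by omega
  have e₂ : n - (ℓ + 1) = n - 1 - ℓ := by omega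
  have e₃ : r - (ℓ : ZMod n) - ((n - 1 - ℓ : ℕ) : ZMod n) = r + 1 := by
    have : ((ℓ + (n - 1 - ℓ) + 1 : ℕ) : ZMod n) = 0 := by
      rw [show ℓ + (n - 1 - ℓ) + 1 = n by omega]; simp
    push_cast at this
    linear_combination -this
  simp only [H]
  rw [e₁, e₂, descProd_succ', descProd_succ b, e₃]
  push_cast
  rw [show r + 1 - ((ℓ : ZMod n) + 1) = r - ℓ by ring,
    show r - ((ℓ : ZMod n) + 1) = r - ℓ - 1 by ring, show r + 1 - (ℓ : ZMod n) - 1 = r - ℓ by ring,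
    show r + 1 - 1 = r by ring]
  ring

lemma kappaSum_telescope {n : ℕ} [NeZero n] (a b h : Vec n) (r : ZMod n) :
    kappaSum n a b (fun m => a m * h m - b m * h (m + 1)) r =
      (∏ m, a m - ∏ m, b m) * h (r + 1) := by
  let G : ℕ → ℝ := fun ℓ =>
    descProd a r ℓ * h (r - (ℓ : ℕ) + 1) * descProd b (r - (ℓ : ℕ)) (n - ℓ)
  have htel := Finset.sum_range_sub G n
  have hends : G n - G 0 = (∏ m, a m - ∏ m, b m) * h (r + 1) := by
    simp only [G, descProd_self, CharP.cast_eq_zero, sub_zero, Nat.sub_zero, Nat.cast_zero,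
      Nat.sub_self]
    simp [descProd]
    ring
  rw [← hends, ← htel, kappaSum]
  refine Finset.sum_congr rfl fun ℓ hℓ => ?_
  have hlt := Finset.mem_range.mp hℓ
  have e₁ : n - ℓ = n - 1 - ℓ + 1 := by omega
  have e₂ : n - (ℓ + 1) = n - 1 - ℓ := by omega
  simp only [G]
  rw [e₁, e₂, descProd_succ, descProd_succ' b]
  push_cast
  rw [show r - ((ℓ : ZMod n) + 1) + 1 = r - ℓ by ring,
    show r - ((ℓ : ZMod n) + 1) = r - ℓ - 1 by ring]
  ring

lemma kappaSum_linear {n : ℕ} (a b f g : Vec n) (α β : ℝ) (r : ZMod n) :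
    kappaSum n a b (fun m => α * f m + β * g m) r =
      α * kappaSum n a b f r + β * kappaSum n a b g r := by
  simp only [kappaSum, Finset.mul_sum, ← Finset.sum_add_distrib]
  exact Finset.sum_congr rfl fun _ _ => by ring

lemma kappaSum_mul_relation {n : ℕ} [NeZero n] (a b c V P : Vec n) (r : ZMod n) :
    (∏ m, a m - ∏ m, c m) *
        kappaSum n a b (fun m => V m * kappaSum n c b P (m - 1)) r +
      (∏ m, c m - ∏ m, b m) * kappaSum n a b (fun m => kappaSum n a c V m * P m) r =
      (∏ m, a m - ∏ m, b m) * (kappaSum n a c V r * kappaSum n c b P r) := by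
  rw [← kappaSum_linear]
  have h := kappaSum_telescope a b
    (fun m => kappaSum n a c V (m - 1) * kappaSum n c b P (m - 1)) r
  simp only [add_sub_cancel_right] at h
  rw [← h]
  congr 1
  funext m
  have h₁ := kappaSum_recurrence a c V (m - 1)
  have h₂ := kappaSum_recurrence c b P (m - 1)
  simp only [sub_add_cancel] at h₁ h₂
  linear_combination -kappaSum n c b P (m - 1) * h₁ - kappaSum n a c V m * h₂

lemma kappaSum_exchange {n : ℕ} [NeZero n] (a b c V P : Vec n) (r : ZMod n) :
    c (r + 1) * kappaSum n a c V (r + 1) *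
          kappaSum n a b (fun m => V m * kappaSum n c b P (m - 1)) r -
        b (r + 1) * kappaSum n a c V r *
          kappaSum n a b (fun m => V m * kappaSum n c b P (m - 1)) (r + 1) =
      (∏ m, c m - ∏ m, b m) *
        (kappaSum n a b (fun m => kappaSum n a c V m * P m) r * V (r + 1)) := by
  have h₁ := kappaSum_recurrence a c V r
  have h₂ := kappaSum_recurrence a b (fun m => V m * kappaSum n c b P (m - 1)) r
  have h₃ := kappaSum_mul_relation a b c V P r
  simp only [add_sub_cancel_right] at h₂
  linear_combination kappaSum n a c V r * h₂ - V (r + 1) * h₃ -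
    kappaSum n a b (fun m => V m * kappaSum n c b P (m - 1)) r * h₁

/-- A telescoping sum turning a cyclic first-order relation between `U` and `Z` into a formula
for `Z`, up to the factor `∏ c - ∏ b`. -/
lemma cyclic_telescope {n : ℕ} [NeZero n] (hn : 2 ≤ n) (b c U W Z : Vec n)
    (h : ∀ r, c (r + 1) * U (r + 1) * Z r - b (r + 1) * U r * Z (r + 1) =
      (∏ m, c m - ∏ m, b m) * W r) (r : ZMod n) :
    (∏ m, c m - ∏ m, b m) * ((∏ t ∈ Finset.range (n - 1), U (r + 1 + (t : ℕ))) * Z r) =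
      (∏ m, c m - ∏ m, b m) *
        ∑ s ∈ Finset.range n,
          (∏ t ∈ Finset.range s, b (r + 1 + (t : ℕ))) *
            (∏ t ∈ Finset.range (n - 1 - s), c (r + (s : ℕ) + 2 + (t : ℕ))) *
            (∏ t ∈ Finset.range (n - 2), U (r + (s : ℕ) + 2 + (t : ℕ))) * W (r + (s : ℕ)) := by
  let F : ℕ → ℝ := fun s =>
    (∏ t ∈ Finset.range s, b (r + 1 + (t : ℕ))) *
      (∏ t ∈ Finset.range (n - s), c (r + (s : ℕ) + 1 + (t : ℕ))) *
      (∏ t ∈ Finset.range (n - 1), U (r + (s : ℕ) + 1 + (t : ℕ))) * Z (r + (s : ℕ))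
  have hends : F 0 - F n =
      (∏ m, c m - ∏ m, b m) * ((∏ t ∈ Finset.range (n - 1), U (r + 1 + (t : ℕ))) * Z r) := by
    simp only [F, prod_range_cyclic, CharP.cast_eq_zero, add_zero, Nat.sub_zero, Nat.cast_zero,
      Nat.sub_self, Finset.prod_range_zero]
    ring
  rw [← hends, ← Finset.sum_range_sub', Finset.mul_sum]
  refine Finset.sum_congr rfl fun s hs => ?_
  have hlt := Finset.mem_range.mp hs
  have e₁ : n - s = n - 1 - s + 1 := by omega
  have e₂ : n - (s + 1) = n - 1 - s := by omega
  have e₃ : n - 1 = n - 2 + 1 := by omega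
  have hcyc : r + s + 2 + ((n - 2 : ℕ) : ZMod n) = r + s := by
    have : ((2 + (n - 2) : ℕ) : ZMod n) = 0 := by
      rw [show 2 + (n - 2) = n by omega]; simp
    push_cast at this
    linear_combination this
  have hc : ∏ t ∈ Finset.range (n - s), c (r + (s : ℕ) + 1 + (t : ℕ)) =
      c (r + s + 1) * ∏ t ∈ Finset.range (n - 1 - s), c (r + (s : ℕ) + 2 + (t : ℕ)) := by
    rw [e₁, Finset.prod_range_succ', mul_comm]
    congr 1
    · simp
    · exact Finset.prod_congr rfl fun t _ => by congr 1; push_cast; ring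
  have hU : ∏ t ∈ Finset.range (n - 1), U (r + (s : ℕ) + 1 + (t : ℕ)) =
      U (r + s + 1) * ∏ t ∈ Finset.range (n - 2), U (r + (s : ℕ) + 2 + (t : ℕ)) := by
    rw [e₃, Finset.prod_range_succ', mul_comm]
    congr 1
    · simp
    · exact Finset.prod_congr rfl fun t _ => by congr 1; push_cast; ring
  have hU' : ∏ t ∈ Finset.range (n - 1), U (r + ((s + 1 : ℕ) : ZMod n) + 1 + (t : ℕ)) =
      (∏ t ∈ Finset.range (n - 2), U (r + (s : ℕ) + 2 + (t : ℕ))) * U (r + s) := by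
    rw [e₃, Finset.prod_range_succ]
    congr 1
    · exact Finset.prod_congr rfl fun t _ => by congr 1; push_cast; ring
    · rw [← hcyc]; congr 1; push_cast; ring
  have hc' : ∏ t ∈ Finset.range (n - (s + 1)), c (r + ((s + 1 : ℕ) : ZMod n) + 1 + (t : ℕ)) =
      ∏ t ∈ Finset.range (n - 1 - s), c (r + (s : ℕ) + 2 + (t : ℕ)) := by
    rw [e₂]
    exact Finset.prod_congr rfl fun t _ => by congr 1; push_cast; ring
  have hrel := h (r + s)
  simp only [F]
  rw [hc, hU, hc', hU', Finset.prod_range_succ,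
    show r + 1 + (s : ZMod n) = r + s + 1 by ring,
    show r + ((s + 1 : ℕ) : ZMod n) = r + s + 1 by push_cast; ring]
  linear_combination (∏ t ∈ Finset.range s, b (r + 1 + (t : ℕ))) *
    (∏ t ∈ Finset.range (n - 1 - s), c (r + (s : ℕ) + 2 + (t : ℕ))) *
    (∏ t ∈ Finset.range (n - 2), U (r + (s : ℕ) + 2 + (t : ℕ))) * hrel

lemma continuous_kappaSum {n : ℕ} {X : Type*} [TopologicalSpace X] {a b f : X → Vec n}
    (ha : Continuous a) (hb : Continuous b) (hf : Continuous f) :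
    Continuous fun z => kappaSum n (a z) (b z) (f z) := by
  unfold kappaSum descProd
  fun_prop

lemma kappaSum_identity {n : ℕ} [NeZero n] (hn : 2 ≤ n) (a b c V P : Vec n)
    (hb : ∀ m, 0 < b m) (r : ZMod n) :
    (∏ t ∈ Finset.range (n - 1), kappaSum n a c V (r + 1 + (t : ℕ))) *
        kappaSum n a b (fun m => V m * kappaSum n c b P (m - 1)) r =
      ∑ s ∈ Finset.range n,
        (∏ t ∈ Finset.range s, b (r + 1 + (t : ℕ))) *
          (∏ t ∈ Finset.range (n - 1 - s), c (r + (s : ℕ) + 2 + (t : ℕ))) *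
          (∏ t ∈ Finset.range (n - 2), kappaSum n a c V (r + (s : ℕ) + 2 + (t : ℕ))) *
          (kappaSum n a b (fun m => kappaSum n a c V m * P m) (r + (s : ℕ)) *
            V (r + (s : ℕ) + 1)) := by
  have generic : ∀ b : Vec n, ∏ m, c m ≠ ∏ m, b m → _ := fun b hne =>
    mul_left_cancel₀ (sub_ne_zero.mpr hne)
      (cyclic_telescope hn b c (kappaSum n a c V)
        (fun r => kappaSum n a b (fun m => kappaSum n a c V m * P m) r * V (r + 1))
        (kappaSum n a b fun m => V m * kappaSum n c b P (m - 1))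
        (kappaSum_exchange a b c V P) r)
  by_cases hne : ∏ m, c m = ∏ m, b m
  swap
  · exact generic b hne
  let B : ℝ → Vec n := fun z m => z * b m
  have hB : Continuous B := by fun_prop
  have hQ : Continuous fun z => kappaSum n c (B z) P :=
    continuous_kappaSum continuous_const hB continuous_const
  have hZ : Continuous fun z =>
      kappaSum n a (B z) (fun m => V m * kappaSum n c (B z) P (m - 1)) :=
    continuous_kappaSum continuous_const hB (by fun_prop)
  have hY : Continuous fun z => kappaSum n a (B z) (fun m => kappaSum n a c V m * P m) :=
    continuous_kappaSum continuous_const hB continuous_const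
  have hL : Continuous fun z =>
      (∏ t ∈ Finset.range (n - 1), kappaSum n a c V (r + 1 + (t : ℕ))) *
        kappaSum n a (B z) (fun m => V m * kappaSum n c (B z) P (m - 1)) r := by
    fun_prop
  have hR : Continuous fun z => ∑ s ∈ Finset.range n,
      (∏ t ∈ Finset.range s, B z (r + 1 + (t : ℕ))) *
        (∏ t ∈ Finset.range (n - 1 - s), c (r + (s : ℕ) + 2 + (t : ℕ))) *
        (∏ t ∈ Finset.range (n - 2), kappaSum n a c V (r + (s : ℕ) + 2 + (t : ℕ))) *
        (kappaSum n a (B z) (fun m => kappaSum n a c V m * P m) (r + (s : ℕ)) *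
          V (r + (s : ℕ) + 1)) := by
    fun_prop
  have hEq : Set.EqOn _ _ (Set.Ioi (1 : ℝ)) := fun z hz => generic (B z) (by
    have hpos : 0 < ∏ m, b m := Finset.prod_pos fun m _ => hb m
    have hpow : 1 < z ^ n := one_lt_pow₀ hz (NeZero.ne n)
    simp only [B, Finset.prod_mul_distrib, Finset.prod_const, Finset.card_univ, ZMod.card, hne]
    nlinarith [mul_pos (sub_pos.mpr hpow) hpos])
  have hcl := hEq.closure hL hR
  rw [closure_Ioi] at hcl
  simpa [B] using hcl (Set.self_mem_Ici (a := (1 : ℝ)))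

lemma tauF_eq (n : ℕ) (r : ZMod n) (K : ℤ) (x : List (Vec n)) :
    tauF n r K x = ∑ c ∈ Fintype.piFinset fun _ : Fin x.length => Finset.range n,
      if ((∑ i, c i : ℕ) : ℤ) = K then
        ∏ i, descProd (x.get i) (r - (∑ i' with i' < i, c i' : ℕ)) (c i) else 0 := by
  rw [tauF, ← Finset.sum_filter]
  split_ifs with hK
  · refine Finset.sum_congr (Finset.filter_congr fun c _ => ?_) fun c _ => rfl
    omega
  · rw [Finset.filter_false_of_mem, Finset.sum_empty]
    intro c _
    omega

lemma tauF_nil (n : ℕ) (r : ZMod n) (K : ℤ) : tauF n r K [] = if K = 0 then 1 else 0 := by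
  rw [tauF_eq]
  simp [eq_comm]

lemma tauF_cons (n : ℕ) (r : ZMod n) (K : ℤ) (y : Vec n) (l : List (Vec n)) :
    tauF n r K (y :: l) =
      ∑ t ∈ Finset.range n, descProd y r t * tauF n (r - (t : ℕ)) (K - t) l := by
  simp_rw [tauF_eq, Finset.mul_sum]
  rw [← Finset.sum_product']
  symm
  refine Finset.sum_bij' (fun p _ => (Fin.cons p.1 p.2 : Fin (l.length + 1) → ℕ))
    (fun c _ => (c 0, Fin.tail c)) ?_ ?_ ?_ ?_ ?_
  · rintro ⟨t, c⟩ hp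
    simpa [Fintype.mem_piFinset, Fin.forall_fin_succ] using hp
  · intro c hc
    simpa [Fintype.mem_piFinset, Fin.forall_fin_succ, Fin.tail] using hc
  · rintro ⟨t, c⟩ -
    simp
  · intro c _
    exact Fin.cons_self_tail c
  · rintro ⟨t, c⟩ -
    have hpre (i : Fin l.length) :
        ∑ i' with i' < i.succ, (Fin.cons t c : Fin (l.length + 1) → ℕ) i' =
          t + ∑ i' with i' < i, c i' := by
      simp [Finset.sum_filter, Fin.sum_univ_succ]
    have hsum : ((∑ i, c i : ℕ) : ℤ) = K - t ↔
        ((∑ i, (Fin.cons t c : Fin (l.length + 1) → ℕ) i : ℕ) : ℤ) = K := by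
      rw [Fin.sum_univ_succ]
      simp only [Fin.cons_zero, Fin.cons_succ]
      omega
    simp only [List.length_cons, ← hsum, mul_ite, mul_zero]
    refine if_congr Iff.rfl ?_ rfl
    rw [Fin.prod_univ_succ]
    simp [hpre, sub_sub]

lemma tauF_of_neg {n : ℕ} (r : ZMod n) {K : ℤ} (hK : K < 0) (x : List (Vec n)) :
    tauF n r K x = 0 :=
  if_neg (not_le.mpr hK)

lemma tauF_of_lt {n : ℕ} (r : ZMod n) {K : ℤ} (x : List (Vec n))
    (hK : ((n - 1 : ℕ) * x.length : ℤ) < K) : tauF n r K x = 0 := by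
  induction x generalizing r K with
  | nil => rw [tauF_nil, if_neg (by simpa using hK.ne')]
  | cons y l ih =>
    rw [tauF_cons]
    refine Finset.sum_eq_zero fun t ht => ?_
    have := Finset.mem_range.mp ht
    rw [ih, mul_zero]
    rw [List.length_cons] at hK
    push_cast at hK
    have : (t : ℤ) ≤ (n - 1 : ℕ) := by omega
    linarith

lemma tauF_snoc (n : ℕ) (r : ZMod n) (K : ℤ) (l : List (Vec n)) (w : Vec n) :
    tauF n r K (l ++ [w]) =
      ∑ t ∈ Finset.range n,
        tauF n r (K - t) l * descProd w (r - ((K - t : ℤ) : ZMod n)) t := by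
  induction l generalizing r K with
  | nil =>
    rw [List.nil_append, tauF_cons]
    refine Finset.sum_congr rfl fun t _ => ?_
    simp only [tauF_nil]
    split_ifs with h <;> simp [h]
  | cons y l ih =>
    simp only [List.cons_append, tauF_cons, ih, Finset.mul_sum, Finset.sum_mul]
    rw [Finset.sum_comm]
    refine Finset.sum_congr rfl fun u _ => Finset.sum_congr rfl fun t _ => ?_
    rw [sub_right_comm K (t : ℤ)]
    push_cast
    rw [show r - (t : ZMod n) - ((K : ZMod n) - u - t) = r - (K - u) by ring]
    ring

lemma sigmaF_cons (n : ℕ) (r : ZMod n) (K : ℕ) (y : Vec n) (l : List (Vec n)) :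
    sigmaF n r K (y :: l) =
      ∑ t ∈ Finset.range (K + 1), descProd y r t * tauF n (r - (t : ℕ)) ((K : ℤ) - t) l :=
  rfl

lemma sigmaF_add {n : ℕ} (r : ZMod n) (e : ℕ) (y : Vec n) (l : List (Vec n)) :
    sigmaF n r ((n - 1) * l.length + e) (y :: l) =
      descProd y r e * sigmaF n (r - (e : ℕ)) ((n - 1) * l.length) (y :: l) := by
  rw [sigmaF_cons, sigmaF_cons, Finset.mul_sum,
    show (n - 1) * l.length + e + 1 = e + ((n - 1) * l.length + 1) by ring, Finset.sum_range_add,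
    Finset.sum_eq_zero, zero_add]
  · refine Finset.sum_congr rfl fun t _ => ?_
    rw [descProd_add, mul_assoc]
    push_cast
    rw [sub_sub, show (n - 1 : ℕ) * (l.length : ℤ) + e - (e + t) =
      (n - 1 : ℕ) * (l.length : ℤ) - t by ring]
  · intro t ht
    have := Finset.mem_range.mp ht
    rw [tauF_of_lt, mul_zero]
    push_cast
    omega

lemma sum_range_tauF_truncate {n : ℕ} {K u : ℕ} (hu : u ≤ K) (g : ℕ → ℝ) (r : ℕ → ZMod n)
    (l : List (Vec n)) :
    ∑ t ∈ Finset.range (K + 1), g t * tauF n (r t) ((K : ℤ) - u - t) l =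
      ∑ t ∈ Finset.range (K - u + 1), g t * tauF n (r t) (((K - u : ℕ) : ℤ) - t) l := by
  rw [show K + 1 = (K - u + 1) + u by omega, Finset.sum_range_add, Nat.cast_sub hu, add_eq_left]
  refine Finset.sum_eq_zero fun t _ => ?_
  rw [tauF_of_neg _ (by omega), mul_zero]

lemma sigmaF_snoc {n : ℕ} (r : ZMod n) {K : ℕ} (hK : n ≤ K + 1) (y w : Vec n)
    (l : List (Vec n)) :
    sigmaF n r K (y :: (l ++ [w])) =
      ∑ u ∈ Finset.range n,
        sigmaF n r (K - u) (y :: l) * descProd w (r - ((K - u : ℕ) : ZMod n)) u := by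
  simp only [sigmaF_cons, tauF_snoc, Finset.mul_sum]
  rw [Finset.sum_comm]
  refine Finset.sum_congr rfl fun u hu => ?_
  have huK : u ≤ K := by have := Finset.mem_range.mp hu; omega
  rw [← sum_range_tauF_truncate huK, Finset.sum_mul]
  refine Finset.sum_congr rfl fun t _ => ?_
  rw [sub_right_comm (K : ℤ), Nat.cast_sub huK]
  push_cast
  rw [show r - (t : ZMod n) - ((K : ZMod n) - u - t) = r - (K - u) by ring]
  ring

lemma sigmaBarF_snoc {n : ℕ} (r : ZMod n) (K : ℕ) (l : List (Vec n)) (w : Vec n) :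
    sigmaBarF n r K (l ++ [w]) =
      ∑ t ∈ Finset.range (K + 1),
        descProd w (r - K + t) t * tauF n r ((K : ℤ) - t) l := by
  have key : ∀ (L : List (Vec n)) (hL : L ≠ []), sigmaBarF n r K L =
      ∑ t ∈ Finset.range (K + 1), tauF n r ((K : ℤ) - t) L.dropLast *
        ∏ β ∈ Finset.range t, L.getLast hL (r - (K : ℕ) + 1 + (β : ℕ)) := by
    rintro (_ | ⟨y, L⟩) hL
    · exact absurd rfl hL
    · rfl
  rw [key _ (by simp)]
  refine Finset.sum_congr rfl fun t _ => ?_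
  rw [List.dropLast_concat, List.getLast_append_singleton, mul_comm, descProd,
    ← Finset.prod_range_reflect]
  congr 1
  refine Finset.prod_congr rfl fun β hβ => ?_
  have := Finset.mem_range.mp hβ
  congr 1
  rw [show t - 1 - β = t - (β + 1) by omega, Nat.cast_sub (by omega)]
  push_cast
  ring

lemma natCast_pred_mul {n : ℕ} [NeZero n] (m : ℕ) :
    (((n - 1) * m : ℕ) : ZMod n) = -m := by
  rw [Nat.cast_mul, Nat.cast_sub (NeZero.one_le)]
  simp

lemma sigmaBarF_add {n : ℕ} [NeZero n] (r : ZMod n) (e : ℕ) (l : List (Vec n)) (w : Vec n) :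
    sigmaBarF n r ((n - 1) * l.length + e) (l ++ [w]) =
      sigmaBarF n r ((n - 1) * l.length) (l ++ [w]) * descProd w (r + l.length) e := by
  rw [sigmaBarF_snoc, sigmaBarF_snoc, Finset.sum_mul,
    show (n - 1) * l.length + e + 1 = e + ((n - 1) * l.length + 1) by ring, Finset.sum_range_add,
    Finset.sum_eq_zero, zero_add]
  · refine Finset.sum_congr rfl fun t _ => ?_
    rw [add_comm e t, descProd_add, Nat.cast_add, natCast_pred_mul]
    push_cast
    rw [show r - (-(l.length : ZMod n) + e) + (t + e) = r - -(l.length : ZMod n) + t by ring,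
      show r - -(l.length : ZMod n) + t - t = r + l.length by ring, add_sub_add_right_eq_sub]
    ring
  · intro t ht
    have := Finset.mem_range.mp ht
    rw [tauF_of_lt, mul_zero]
    push_cast
    omega

lemma sigmaBarF_cons {n : ℕ} (r : ZMod n) {K : ℕ} (hK : n ≤ K + 1) (y w : Vec n)
    (l : List (Vec n)) :
    sigmaBarF n r K (y :: (l ++ [w])) =
      ∑ u ∈ Finset.range n,
        descProd y r u * sigmaBarF n (r - (u : ℕ)) (K - u) (l ++ [w]) := by
  rw [← List.cons_append]
  simp only [sigmaBarF_snoc, tauF_cons, Finset.mul_sum]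
  rw [Finset.sum_comm]
  refine Finset.sum_congr rfl fun u hu => ?_
  have huK : u ≤ K := by have := Finset.mem_range.mp hu; omega
  rw [← Finset.mul_sum, ← sum_range_tauF_truncate huK, Finset.mul_sum]
  refine Finset.sum_congr rfl fun t _ => ?_
  rw [sub_right_comm (K : ℤ), Nat.cast_sub huK]
  rw [show r - (u : ZMod n) - ((K : ZMod n) - u) + t = r - K + t by ring]
  ring

lemma descProd_shift {n : ℕ} (y : Vec n) (d r : ZMod n) (t : ℕ) :
    descProd (fun m => y (m + d)) r t = descProd y (r + d) t :=
  Finset.prod_congr rfl fun _ _ => congrArg y (sub_add_eq_add_sub _ _ _)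

lemma kappaSum_shift {n : ℕ} (a b f : Vec n) (d r : ZMod n) :
    kappaSum n (fun m => a (m + d)) (fun m => b (m + d)) (fun m => f (m + d)) r =
      kappaSum n a b f (r + d) := by
  refine Finset.sum_congr rfl fun ℓ _ => ?_
  rw [descProd_shift, descProd_shift]
  ring_nf

lemma sigmaF_eq_kappaSum {n : ℕ} [NeZero n] (r : ZMod n) (y w : Vec n) (l : List (Vec n)) :
    sigmaF n r ((n - 1) * (l.length + 1)) (y :: (l ++ [w])) =
      kappaSum n y (fun m => w (m + (l.length + 1)))
        (fun m => sigmaF n m ((n - 1) * l.length) (y :: l)) r := by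
  have hn : 1 ≤ n := NeZero.one_le
  rw [sigmaF_snoc r (by rw [mul_add]; omega), ← Finset.sum_range_reflect]
  refine Finset.sum_congr rfl fun ℓ hℓ => ?_
  have := Finset.mem_range.mp hℓ
  have e : (n - 1) * (l.length + 1) - (n - 1 - ℓ) = (n - 1) * l.length + ℓ := by
    rw [mul_add]; omega
  rw [e, sigmaF_add, descProd_shift, Nat.cast_add, natCast_pred_mul]
  congr 2
  ring

lemma sigmaBarF_eq_kappaSum {n : ℕ} [NeZero n] (r : ZMod n) (y w : Vec n) (l : List (Vec n)) :
    sigmaBarF n r ((n - 1) * (l.length + 1)) (y :: (l ++ [w])) =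
      kappaSum n y (fun m => w (m + (l.length + 1)))
        (fun m => sigmaBarF n m ((n - 1) * l.length) (l ++ [w])) r := by
  have hn : 1 ≤ n := NeZero.one_le
  rw [sigmaBarF_cons r (by rw [mul_add]; omega)]
  refine Finset.sum_congr rfl fun ℓ hℓ => ?_
  have := Finset.mem_range.mp hℓ
  have e : (n - 1) * (l.length + 1) - ℓ = (n - 1) * l.length + (n - 1 - ℓ) := by
    rw [mul_add]; omega
  rw [e, sigmaBarF_add, descProd_shift, mul_assoc]
  congr 3
  ring

lemma sum_sigmaF_mul_sigmaBarF {n : ℕ} [NeZero n] (r : ZMod n) (y w : Vec n)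
    (l l' : List (Vec n)) :
    ∑ ℓ ∈ Finset.range n, sigmaF n r ((n - 1) * l.length + ℓ) (y :: l) *
        sigmaBarF n (r + l.length - (ℓ : ℕ)) ((n - 1) * (l'.length + 1) - ℓ) (l' ++ [w]) =
      kappaSum n y (fun m => w (m + (l.length + l'.length + 1)))
        (fun m => sigmaF n m ((n - 1) * l.length) (y :: l) *
          sigmaBarF n (m + l.length) ((n - 1) * l'.length) (l' ++ [w])) r := by
  refine Finset.sum_congr rfl fun ℓ hℓ => ?_
  have := Finset.mem_range.mp hℓ
  have e : (n - 1) * (l'.length + 1) - ℓ = (n - 1) * l'.length + (n - 1 - ℓ) := by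
    rw [mul_add]; omega
  rw [e, sigmaF_add, sigmaBarF_add, descProd_shift]
  ring_nf

lemma length_seg {n : ℕ} (x : ℕ → Vec n) (i p : ℕ) : (seg x (i + 1) (i + p)).length = p := by
  simp [seg]

lemma seg_eq_cons {n : ℕ} (x : ℕ → Vec n) (i p : ℕ) :
    seg x i (i + p) = x i :: seg x (i + 1) (i + p) := by
  rw [seg, seg, show i + p + 1 - i = p + 1 by omega, show i + p + 1 - (i + 1) = p by omega,
    List.range_succ_eq_map]
  simp [Function.comp_def, add_assoc, add_comm 1]

lemma seg_eq_snoc {n : ℕ} (x : ℕ → Vec n) (i p : ℕ) :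
    seg x (i + 1) (i + p + 1) = seg x (i + 1) (i + p) ++ [x (i + p + 1)] := by
  rw [seg, seg, show i + p + 1 + 1 - (i + 1) = p + 1 by omega,
    show i + p + 1 - (i + 1) = p by omega, List.range_succ]
  simp [add_right_comm]

lemma OmegaF_eq_kappaSum {n : ℕ} [NeZero n] (r : ZMod n) (i p q : ℕ) (x : ℕ → Vec n) :
    OmegaF n r (i + p) i (i + p + q + 1) x =
      kappaSum n (x i) (fun m => x (i + p + q + 1) (m + (p + q + 1)))
        (fun m => sigmaF n m ((n - 1) * p) (seg x i (i + p)) *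
          sigmaBarF n (m + p) ((n - 1) * q) (seg x (i + p + 1) (i + p + q + 1))) r := by
  have h := sum_sigmaF_mul_sigmaBarF r (x i) (x (i + p + q + 1)) (seg x (i + 1) (i + p))
    (seg x (i + p + 1) (i + p + q))
  rw [← seg_eq_cons, ← seg_eq_snoc, length_seg, length_seg] at h
  rw [← h, OmegaF]
  refine Finset.sum_congr rfl fun ℓ _ => ?_
  rw [Nat.add_sub_cancel_left, show i + p + q + 1 - (i + p) = q + 1 by omega]
  congr 2
  push_cast
  ring

/-- the main identity relating `Ω_{k-1}` and `Ω_k`: for `i < k ≤ j-1`,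
`(Π_{t=1}^{n-1} σ_{(n-1)(k-i)}^{(r-k+i+t)}(x_i,…,x_k)) Ω_{k-1}^{(r-k+i)}(x_i,…,x_j)
= Σ_{s=0}^{n-1} (Π_{t=r+1}^{r+s} x_j^{(t+j-k)}) (Π_{t=r+s+1}^{r+n-1} x_k^{(t+1)})
(Π_{t=s+2}^{s+n-1} σ_{(n-1)(k-i)}^{(r-k+i+t)}(x_i,…,x_k)) Ω_k^{(r-k+i+s)}(x_i,…,x_j)
σ_{(n-1)(k-i-1)}^{(r-k+i+s+1)}(x_i,…,x_{k-1})`. -/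
theorem Omega_identity (n : ℕ) (hn : 2 ≤ n) (x : ℕ → Vec n) (hx : ∀ p r, 0 < x p r)
    (i k j : ℕ) (hik : i < k) (hkj : k ≤ j - 1) (hij : i < j) (r : ZMod n) :
    (∏ t ∈ Finset.range (n - 1),
        sigmaF n (r - (k : ℕ) + (i : ℕ) + ((t : ℕ) + 1)) ((n - 1) * (k - i)) (seg x i k)) *
      OmegaF n (r - (k : ℕ) + (i : ℕ)) (k - 1) i j x =
    ∑ s ∈ Finset.range n,
      (∏ t ∈ Finset.range s, x j (r + ((t : ℕ) + 1) + (j : ℕ) - (k : ℕ))) *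
        (∏ t ∈ Finset.range (n - 1 - s), x k (r + (s : ℕ) + 1 + (t : ℕ) + 1)) *
        (∏ t ∈ Finset.range (n - 2),
          sigmaF n (r - (k : ℕ) + (i : ℕ) + ((s : ℕ) + 2 + (t : ℕ))) ((n - 1) * (k - i))
            (seg x i k)) *
        OmegaF n (r - (k : ℕ) + (i : ℕ) + (s : ℕ)) k i j x *
        sigmaF n (r - (k : ℕ) + (i : ℕ) + (s : ℕ) + 1) ((n - 1) * (k - i - 1))
          (seg x i (k - 1)) := by
  have : NeZero n := ⟨by omega⟩
  obtain ⟨p, rfl⟩ : ∃ p, k = i + p + 1 := ⟨k - i - 1, by omega⟩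
  obtain ⟨q, rfl⟩ : ∃ q, j = i + p + 1 + q + 1 := ⟨j - (i + p + 1) - 1, by omega⟩
  set k := i + p + 1 with hk
  set j := k + q + 1 with hj
  let b : Vec n := fun m => x j (m + (p + q + 2))
  let c : Vec n := fun m => x k (m + (p + 1))
  let V : Vec n := fun m => sigmaF n m ((n - 1) * p) (seg x i (i + p))
  let P : Vec n := fun m => sigmaBarF n (m + (p + 1)) ((n - 1) * q) (seg x (k + 1) j)
  have hU (m : ZMod n) :
      sigmaF n m ((n - 1) * (p + 1)) (seg x i k) = kappaSum n (x i) c V m := by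
    have h := sigmaF_eq_kappaSum m (x i) (x k) (seg x (i + 1) (i + p))
    rw [← seg_eq_snoc, ← seg_eq_cons, length_seg] at h
    rw [hk, add_assoc, seg_eq_cons, ← add_assoc]
    exact h
  have hQ (m : ZMod n) :
      sigmaBarF n (m + p) ((n - 1) * (q + 1)) (seg x k j) = kappaSum n c b P (m - 1) := by
    have h := sigmaBarF_eq_kappaSum (m + (p : ZMod n)) (x k) (x j) (seg x (k + 1) (k + q))
    rw [← seg_eq_snoc, length_seg] at h
    rw [hj, add_assoc, seg_eq_cons, ← add_assoc, h,
      show m + (p : ZMod n) = m - 1 + (p + 1) by ring, ← kappaSum_shift]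
    congr 1
    funext m
    exact congrArg (x j) (by ring)
  have hY (m : ZMod n) : OmegaF n m k i j x =
      kappaSum n (x i) b (fun m => kappaSum n (x i) c V m * P m) m := by
    have h := OmegaF_eq_kappaSum m i (p + 1) q x
    rw [← add_assoc i p 1, ← hk, ← hj] at h
    rw [h]
    simp only [hU, P]
    push_cast
    congr 1
    funext m
    exact congrArg (x j) (by ring)
  have hZ (m : ZMod n) : OmegaF n m (k - 1) i j x =
      kappaSum n (x i) b (fun m => V m * kappaSum n c b P (m - 1)) m := by
    have h := OmegaF_eq_kappaSum m i p (q + 1) x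
    rw [show i + p + (q + 1) + 1 = j by omega, ← hk] at h
    rw [show k - 1 = i + p by omega, h]
    simp only [← hQ, V]
    push_cast
    congr 1
    funext m
    exact congrArg (x j) (by ring)
  have main := kappaSum_identity hn (x i) b c V P (fun m => hx j _) (r - (k : ℕ) + (i : ℕ))
  rw [show k - i = p + 1 by omega, show p + 1 - 1 = p by omega]
  rw [show k - 1 = i + p by omega] at hZ ⊢
  simp only [hU, hY, hZ]
  have hkc : (k : ZMod n) = i + p + 1 := by rw [hk]; push_cast; ring
  have hjc : (j : ZMod n) = k + q + 1 := by rw [hj]; push_cast; ring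
  convert main using 1
  · congr 1
    exact Finset.prod_congr rfl fun t _ => by ring_nf
  · refine Finset.sum_congr rfl fun s _ => ?_
    rw [mul_assoc _ (kappaSum _ _ _ _ _)]
    congr 1
    congr 1
    · congr 1
      · exact Finset.prod_congr rfl fun t _ => congrArg (x j) (by rw [hjc, hkc]; ring)
      · exact Finset.prod_congr rfl fun t _ => congrArg (x k) (by rw [hkc]; ring)
    · exact Finset.prod_congr rfl fun t _ => by ring_nf
end
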